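/- arXiv:1304.0733 — 2 statements merged into one kernel-verified Lean document; each statement's English description precedes it below -/
import Mathlib

section
/- Let L be an R-trivial regular language over a two-letter alphabet with sc(L) = n, where n ≥ 2. Then sc(L^R) ≤ 2^{n-2} + n - 1. -/
/-- A DFA is *partially ordered* if its reachability relation
`p ≼ q ↔ ∃ w, M.evalFrom p w = q` is antisymmetric (hence a partial order). -/
def DFA.PartiallyOrderedDFA {α σ : Type} (M : DFA α σ) : Prop :=
  ∀ p q : σ, (∃ w : List α, M.evalFrom p w = q) → (∃ w : List α, M.evalFrom q w = p) → p = q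

/-- A DFA is *minimal* if every state is reachable from the initial state and
all pairs of distinct states are distinguishable. -/
def DFA.MinimalDFA {α σ : Type} (M : DFA α σ) : Prop :=
  (∀ q : σ, ∃ w : List α, M.evalFrom M.start w = q) ∧
  (∀ p q : σ, p ≠ q →
    ∃ w : List α, ¬ (M.evalFrom p w ∈ M.accept ↔ M.evalFrom q w ∈ M.accept))

/-- The *state complexity* of a language: the least number of states of a
(complete, deterministic) finite automaton accepting it. -/
noncomputable def stateComplexity {α : Type} (L : Language α) : ℕ :=
  sInf {n : ℕ | ∃ M : DFA α (Fin n), M.accepts = L}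

/-- A regular language is *R-trivial* iff its minimal DFA is partially ordered. -/
def IsRTrivial {α : Type} (L : Language α) : Prop :=
  ∃ (n : ℕ) (M : DFA α (Fin n)), M.MinimalDFA ∧ M.accepts = L ∧ M.PartiallyOrderedDFA

/-- A regular language is *J-trivial* iff the minimal DFAs of both the language
and its reverse are partially ordered. -/
def IsJTrivial {α : Type} (L : Language α) : Prop :=
  IsRTrivial L ∧ IsRTrivial L.reverse

/-- A *dead state*: a non-accepting state with a self-loop under every letter. -/
def DFA.DeadState {α σ : Type} (M : DFA α σ) (d : σ) : Prop :=
  d ∉ M.accept ∧ ∀ a : α, M.step d a = d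

namespace DFA

variable {α σ : Type}

/-- The set of states from which `w` leads to acceptance. -/
def acceptedFrom (M : DFA α σ) (w : List α) : Set σ :=
  {q | M.evalFrom q w ∈ M.accept}

theorem mem_acceptedFrom {M : DFA α σ} {w : List α} {q : σ} :
    q ∈ M.acceptedFrom w ↔ M.evalFrom q w ∈ M.accept := Iff.rfl

/-- The subset automaton for the reversed language, restricted to the reachable subsets. -/
def reverseSubset (M : DFA α σ) : DFA α (Set.range M.acceptedFrom) where
  step T a := ⟨{q | M.step q a ∈ T.1}, by
    obtain ⟨_, w, rfl⟩ := T
    exact ⟨a :: w, rfl⟩⟩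
  start := ⟨M.acceptedFrom [], [], rfl⟩
  accept := {T | M.start ∈ T.1}

theorem reverseSubset_eval (M : DFA α σ) (w : List α) :
    (M.reverseSubset.eval w).1 = M.acceptedFrom w.reverse := by
  induction w using List.reverseRecOn with
  | nil => rfl
  | append_singleton w a ih =>
    rw [DFA.eval_append_singleton]
    ext q
    change M.step q a ∈ (M.reverseSubset.eval w).1 ↔ _
    rw [ih]
    simp [acceptedFrom, DFA.evalFrom_cons]

theorem reverseSubset_accepts (M : DFA α σ) : M.reverseSubset.accepts = M.accepts.reverse := by
  ext w
  rw [Language.mem_reverse, DFA.mem_accepts, DFA.mem_accepts]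
  change M.start ∈ (M.reverseSubset.eval w).1 ↔ _
  rw [reverseSubset_eval]
  rfl

/-- Reachability in a finite partially ordered automaton admits a rank function. -/
theorem PartiallyOrderedDFA.exists_rank [Finite σ] {M : DFA α σ} (h : M.PartiallyOrderedDFA) :
    ∃ r : σ → ℕ, ∀ q a, M.step q a ≠ q → r (M.step q a) < r q := by
  refine ⟨fun q => {q' | ∃ w : List α, M.evalFrom q w = q'}.ncard, fun q a hne => ?_⟩
  refine Set.ncard_lt_ncard ⟨?_, fun hsub => hne ?_⟩ (Set.toFinite _)
  · rintro _ ⟨w, rfl⟩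
    exact ⟨a :: w, DFA.evalFrom_cons _ _ _ _⟩
  · exact h _ _ (hsub ⟨[], rfl⟩) ⟨[a], rfl⟩

theorem evalFrom_replicate (M : DFA α σ) (q : σ) (a : α) (i : ℕ) :
    M.evalFrom q (List.replicate i a) = (fun q => M.step q a)^[i] q := by
  induction i generalizing q with
  | zero => rfl
  | succ i ih => rw [List.replicate_succ, DFA.evalFrom_cons, ih, Function.iterate_succ_apply]

theorem MinimalDFA.card_le {m n : ℕ} {M : DFA α (Fin m)} (hM : M.MinimalDFA)
    (N : DFA α (Fin n)) (h : N.accepts = M.accepts) : m ≤ n := by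
  choose w hw using hM.1
  have key : Function.Injective fun q => N.eval (w q) := by
    intro p q hpq
    by_contra hne
    obtain ⟨v, hv⟩ := hM.2 p q hne
    have aux (q : Fin m) : M.evalFrom q v ∈ M.accept ↔ N.evalFrom (N.eval (w q)) v ∈ N.accept := by
      have h₁ : w q ++ v ∈ N.accepts ↔ w q ++ v ∈ M.accepts := by rw [h]
      rw [DFA.mem_accepts, DFA.mem_accepts, DFA.eval, DFA.eval, DFA.evalFrom_of_append,
        DFA.evalFrom_of_append, hw q] at h₁
      exact h₁.symm
    apply hv
    rw [aux, aux]
    simp only at hpq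
    rw [hpq]
  simpa using Fintype.card_le_of_injective _ key

end DFA

theorem stateComplexity_le_card {α σ : Type} [Finite σ] (M : DFA α σ) :
    stateComplexity M.accepts ≤ Nat.card σ := by
  apply Nat.sInf_le
  exact ⟨DFA.reindex (Finite.equivFin σ) M, DFA.accepts_reindex _ _⟩

theorem exists_dfa_stateComplexity {α : Type} {L : Language α} {m : ℕ} {M : DFA α (Fin m)}
    (h : M.accepts = L) : ∃ N : DFA α (Fin (stateComplexity L)), N.accepts = L :=
  Nat.sInf_mem (s := {n : ℕ | ∃ M : DFA α (Fin n), M.accepts = L}) ⟨m, M, h⟩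

theorem DFA.MinimalDFA.stateComplexity_eq {α : Type} {m : ℕ} {M : DFA α (Fin m)}
    (hM : M.MinimalDFA) : stateComplexity M.accepts = m := by
  obtain ⟨N, hN⟩ := exists_dfa_stateComplexity (M := M) rfl
  exact le_antisymm (Nat.sInf_le ⟨M, rfl⟩) (hM.card_le N hN)

/-- A family of subsets whose traces on two distinct points `p`, `z` are constant. -/
theorem Set.ncard_le_two_pow_of_mem_iff {n : ℕ} {p z : Fin n} (hpz : p ≠ z) {P Z : Prop}
    {C : Set (Set (Fin n))} (hp : ∀ T ∈ C, p ∈ T ↔ P) (hz : ∀ T ∈ C, z ∈ T ↔ Z) :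
    C.ncard ≤ 2 ^ (n - 2) := by
  have hcard : ({p, z}ᶜ : Set (Fin n)).ncard = n - 2 := by
    rw [Set.ncard_compl, Set.ncard_pair hpz, Nat.card_eq_fintype_card, Fintype.card_fin]
  rw [← hcard, ← Set.ncard_powerset]
  refine Set.ncard_le_ncard_of_injOn (fun T => T ∩ {p, z}ᶜ) (fun T _ => Set.inter_subset_right)
    ?_ (Set.toFinite _)
  intro S hS T hT hST
  ext q
  by_cases hqp : q = p
  · rw [hqp, hp S hS, hp T hT]
  by_cases hqz : q = z
  · rw [hqz, hz S hS, hz T hT]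
  have := Set.ext_iff.1 hST q
  simpa [hqp, hqz] using this

/-- A rank-decreasing self-map of `Fin n` with two fixed points stabilizes after `n - 2` steps. -/
theorem iterate_fixed_of_rank {n : ℕ} (hn : 2 ≤ n) {f : Fin n → Fin n} {r : Fin n → ℕ}
    (hr : ∀ q, f q ≠ q → r (f q) < r q) {p z : Fin n} (hpz : p ≠ z) (hp : f p = p) (hz : f z = z)
    (q : Fin n) : f (f^[n - 2] q) = f^[n - 2] q := by
  by_contra hne
  have hfix (i : ℕ) (hi : i ≤ n - 2) : f (f^[i] q) ≠ f^[i] q := by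
    intro h
    apply hne
    obtain ⟨k, hk⟩ := Nat.exists_eq_add_of_le hi
    rw [hk, Nat.add_comm, Function.iterate_add_apply, Function.iterate_fixed h, h]
  have hanti : StrictAntiOn (fun i => r (f^[i] q)) (Set.Iic (n - 1)) := by
    refine strictAntiOn_of_succ_lt Set.ordConnected_Iic fun i _ _ hi => ?_
    simp only [Order.succ_eq_add_one, Set.mem_Iic] at hi
    change r (f^[i + 1] q) < r (f^[i] q)
    rw [Function.iterate_succ_apply']
    exact hr _ (hfix i (by omega))
  have hcard := Finset.card_le_card_of_injOn (s := Finset.range (n - 1))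
    (t := ({p, z}ᶜ : Finset (Fin n))) (fun i => f^[i] q) (by
      intro i hi
      have hi' : i < n - 1 := by simpa using hi
      have := hfix i (by omega)
      simp only [Finset.coe_compl, Finset.coe_insert, Finset.coe_singleton, Set.mem_compl_iff,
        Set.mem_insert_iff, Set.mem_singleton_iff, not_or]
      constructor
      · intro h
        rw [h] at this
        exact this hp
      · intro h
        rw [h] at this
        exact this hz) (by
      intro i hi j hj hij
      have hi' : i < n - 1 := by simpa using hi
      have hj' : j < n - 1 := by simpa using hj
      exact hanti.injOn (Set.mem_Iic.2 hi'.le) (Set.mem_Iic.2 hj'.le) (congrArg r hij))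
  rw [Finset.card_range, Finset.card_compl, Finset.card_pair hpz, Fintype.card_fin] at hcard
  omega

theorem Function.iterate_eq_iterate_min {X : Type*} {f : X → X} {k : ℕ}
    (h : ∀ q, f (f^[k] q) = f^[k] q) (i : ℕ) : f^[i] = f^[min i k] := by
  rcases le_total i k with hik | hik
  · rw [min_eq_left hik]
  · rw [min_eq_right hik]
    obtain ⟨j, rfl⟩ := Nat.exists_eq_add_of_le hik
    funext q
    rw [Nat.add_comm, Function.iterate_add_apply, Function.iterate_fixed (h q)]

namespace DFA

theorem evalFrom_eq_self {α σ : Type} {M : DFA α σ} {q : σ} (h : ∀ a, M.step q a = q)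
    (w : List α) : M.evalFrom q w = q := by
  induction w with
  | nil => rfl
  | cons a w ih => rw [DFA.evalFrom_cons, h, ih]

/-- In a partially ordered automaton some state is a sink, and some other state
leads only to itself and to that sink. -/
theorem PartiallyOrderedDFA.exists_last_states {α : Type} {n : ℕ} (hn : 2 ≤ n) {M : DFA α (Fin n)}
    (h : M.PartiallyOrderedDFA) : ∃ p z : Fin n, p ≠ z ∧ (∀ a, M.step z a = z) ∧
      ∀ a, M.step p a = p ∨ M.step p a = z := by
  obtain ⟨r, hr⟩ := h.exists_rank
  obtain ⟨z, -, hz⟩ := Finset.exists_min_image (Finset.univ : Finset (Fin n)) r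
    ⟨⟨0, by omega⟩, Finset.mem_univ _⟩
  have hne : (Finset.univ.erase z).Nonempty := by
    rw [← Finset.card_pos, Finset.card_erase_of_mem (Finset.mem_univ _), Finset.card_univ,
      Fintype.card_fin]
    omega
  obtain ⟨p, hp, hpmin⟩ := Finset.exists_min_image _ r hne
  refine ⟨p, z, Finset.ne_of_mem_erase hp, fun a => ?_, fun a => ?_⟩
  · by_contra hza
    exact absurd (hr z a hza) (hz _ (Finset.mem_univ _)).not_gt
  · by_contra! hpa
    exact absurd (hr p a hpa.1)
      (hpmin _ (Finset.mem_erase.2 ⟨hpa.2, Finset.mem_univ _⟩)).not_gt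

theorem PartiallyOrderedDFA.ncard_range_acceptedFrom_le {n : ℕ} (hn : 2 ≤ n)
    {M : DFA (Fin 2) (Fin n)} (h : M.PartiallyOrderedDFA) :
    (Set.range M.acceptedFrom).ncard ≤ 2 ^ (n - 2) + n - 1 := by
  obtain ⟨p, z, hpz, hz, hp⟩ := h.exists_last_states hn
  have hzw (w : List (Fin 2)) : z ∈ M.acceptedFrom w ↔ z ∈ M.accept := by
    rw [mem_acceptedFrom, evalFrom_eq_self hz]
  by_cases hpp : ∀ a, M.step p a = p
  · have := Set.ncard_le_two_pow_of_mem_iff hpz (C := Set.range M.acceptedFrom)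
      (P := p ∈ M.accept) (Z := z ∈ M.accept)
      (by
        rintro _ ⟨w, rfl⟩
        rw [mem_acceptedFrom, evalFrom_eq_self hpp])
      (by
        rintro _ ⟨w, rfl⟩
        exact hzw w)
    omega
  push Not at hpp
  obtain ⟨b, hb⟩ := hpp
  obtain ⟨a, hab⟩ : ∃ a : Fin 2, ∀ c, c = a ∨ c = b := ⟨1 - b, by clear * -; decide +revert⟩
  have hword (w : List (Fin 2)) : M.evalFrom p w = z ∨
      ∃ i, w = List.replicate i a ∧ (M.step p a ≠ p → i = 0) := by
    induction w with
    | nil => exact Or.inr ⟨0, rfl, fun _ => rfl⟩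
    | cons c w ih =>
      rw [DFA.evalFrom_cons]
      rcases hp c with hc | hc
      · rw [hc]
        refine ih.imp_right ?_
        obtain rfl : c = a := (hab c).resolve_right fun hcb => hb (hcb ▸ hc)
        rintro ⟨i, rfl, -⟩
        exact ⟨i + 1, rfl, fun hne => absurd hc hne⟩
      · left
        rw [hc, evalFrom_eq_self hz]
  have hsub : Set.range M.acceptedFrom ⊆ M.acceptedFrom '' {w | M.evalFrom p w = z} ∪
      (fun i => M.acceptedFrom (List.replicate i a)) '' (Finset.range (n - 1) : Set ℕ) := by
    rintro _ ⟨w, rfl⟩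
    rcases hword w with hw | ⟨i, rfl, hi⟩
    · exact Or.inl ⟨w, hw, rfl⟩
    right
    by_cases hpa : M.step p a = p
    · refine ⟨min i (n - 2), ?_, ?_⟩
      · rw [Finset.mem_coe, Finset.mem_range]
        omega
      · obtain ⟨r, hr⟩ := h.exists_rank
        have hstab := Function.iterate_eq_iterate_min
          (iterate_fixed_of_rank hn (fun q => hr q a) hpz hpa (hz a)) i
        simp only [acceptedFrom, evalFrom_replicate, hstab]
    · refine ⟨i, ?_, rfl⟩
      rw [hi hpa, Finset.mem_coe, Finset.mem_range]
      omega
  have h₁ := Set.ncard_le_two_pow_of_mem_iff hpz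
    (C := M.acceptedFrom '' {w | M.evalFrom p w = z}) (P := z ∈ M.accept) (Z := z ∈ M.accept)
    (by
      rintro _ ⟨w, hw, rfl⟩
      rw [mem_acceptedFrom, show M.evalFrom p w = z from hw])
    (by
      rintro _ ⟨w, -, rfl⟩
      exact hzw w)
  have h₂ := Set.ncard_image_le (f := fun i => M.acceptedFrom (List.replicate i a))
    (Finset.finite_toSet (Finset.range (n - 1)))
  rw [Set.ncard_coe_finset, Finset.card_range] at h₂
  have h₃ := Set.ncard_le_ncard hsub (Set.toFinite _)
  have h₄ := Set.ncard_union_le (M.acceptedFrom '' {w | M.evalFrom p w = z})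
    ((fun i => M.acceptedFrom (List.replicate i a)) '' (Finset.range (n - 1) : Set ℕ))
  omega

end DFA

theorem statement3 (n : ℕ) (hn : 2 ≤ n) (L : Language (Fin 2))
    (hR : IsRTrivial L) (hsc : stateComplexity L = n) :
    stateComplexity L.reverse ≤ 2 ^ (n - 2) + n - 1 := by
  obtain ⟨m, M, hmin, rfl, hpo⟩ := hR
  obtain rfl : m = n := hmin.stateComplexity_eq.symm.trans hsc
  rw [← M.reverseSubset_accepts]
  refine (stateComplexity_le_card _).trans ?_
  rw [Nat.card_coe_set_eq]
  exact hpo.ncard_range_acceptedFrom_le hn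
end

section
/- Let n ≥ 8. Every R-trivial regular language L over a two-letter alphabet with sc(L) = n satisfies sc(L^R) ≤ 2^{n-2}, and this bound is tight: there exists an R-trivial regular language L over a two-letter alphabet with sc(L) = n and sc(L^R) = 2^{n-2}. -/
/-- The state complexity of a language with finitely many left quotients is their number. -/
theorem stateComplexity_eq_ncard {α : Type} {L : Language α}
    (hL : (Set.range L.leftQuotient).Finite) :
    stateComplexity L = (Set.range L.leftQuotient).ncard := by
  have hmem : (Set.range L.leftQuotient).ncard ∈ {n : ℕ | ∃ M : DFA α (Fin n), M.accepts = L} := by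
    have := hL.to_subtype
    exact ⟨L.toDFA.reindex (Finite.equivFin (Set.range L.leftQuotient)),
      (DFA.accepts_reindex _ _).trans (Language.accepts_toDFA L)⟩
  refine le_antisymm (Nat.sInf_le hmem) (le_csInf ⟨_, hmem⟩ ?_)
  rintro k ⟨M, rfl⟩
  rw [Language.leftQuotient_accepts]
  calc (Set.range (M.acceptsFrom ∘ M.eval)).ncard
      ≤ (Set.range M.acceptsFrom).ncard :=
        Set.ncard_le_ncard (Set.range_comp_subset_range _ _) (Set.toFinite _)
    _ ≤ (Set.univ : Set (Fin k)).ncard := by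
        rw [← Set.image_univ]
        exact Set.ncard_image_le
    _ = k := by simp [Set.ncard_univ]

theorem DFA.MinimalDFA.stateComplexity_accepts {α : Type} {k : ℕ} {M : DFA α (Fin k)}
    (hM : M.MinimalDFA) : stateComplexity M.accepts = k := by
  have hsurj : Function.Surjective M.eval := hM.1
  have hinj : Function.Injective M.acceptsFrom := by
    intro p q hpq
    by_contra hne
    obtain ⟨w, hw⟩ := hM.2 p q hne
    apply hw
    rw [← DFA.mem_acceptsFrom, ← DFA.mem_acceptsFrom, hpq]
  have hrange : Set.range (Language.leftQuotient M.accepts) = Set.range M.acceptsFrom := by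
    rw [Language.leftQuotient_accepts, hsurj.range_comp]
  rw [stateComplexity_eq_ncard (hrange ▸ Set.toFinite _), hrange, ← Set.image_univ,
    Set.ncard_image_of_injective _ hinj]
  simp [Set.ncard_univ]

/-- Two proper subgroups cover at most three quarters of a finite group. -/
theorem AddSubgroup.four_mul_ncard_union_le {G : Type*} [AddGroup G] [Finite G]
    {H K : AddSubgroup G} (hH : H ≠ ⊤) (hK : K ≠ ⊤) :
    4 * ((H : Set G) ∪ K).ncard ≤ 3 * Nat.card G := by
  have h1 := H.card_mul_index
  have h2 := K.card_mul_index
  have h3 := (H ⊓ K).card_mul_index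
  have h4 : (H ⊓ K).index ≤ H.index * K.index := AddSubgroup.index_inf_le
  have h5 := H.one_lt_index_of_ne_top hH
  have h6 := K.one_lt_index_of_ne_top hK
  have h7 : ((H : Set G) ∪ K).ncard + Nat.card ↥(H ⊓ K) = Nat.card H + Nat.card K :=
    Set.ncard_union_add_ncard_inter (H : Set G) K
  have h8 : Nat.card G ≤ Nat.card ↥(H ⊓ K) * (H.index * K.index) := by
    rw [← h3]; gcongr
  generalize Nat.card G = N at *
  generalize Nat.card ↥(H ⊓ K) = i at *
  generalize ((H : Set G) ∪ K).ncard = u at *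
  generalize Nat.card H = x at *
  generalize Nat.card K = y at *
  generalize H.index = h at *
  generalize K.index = k at *
  clear h3 h4
  have hpos : 0 < h * k := by positivity
  refine Nat.le_of_mul_le_mul_right ?_ hpos
  have e : u * (h * k) + i * (h * k) = N * k + N * h := by
    rw [← add_mul, h7]; linear_combination k * h1 + h * h2
  obtain ⟨h, rfl⟩ := Nat.exists_eq_add_of_le h5
  obtain ⟨k, rfl⟩ := Nat.exists_eq_add_of_le h6
  nlinarith [Nat.zero_le (N * h * k), Nat.zero_le (N * h), Nat.zero_le (N * k)]

theorem DFA.evalFrom_replicate_s5 {α σ : Type*} (M : DFA α σ) (q : σ) (b : α) (k : ℕ) :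
    M.evalFrom q (List.replicate k b) = (fun p => M.step p b)^[k] q := by
  induction k generalizing q with
  | zero => rfl
  | succ k ih => simp [List.replicate_succ, ih]

namespace DFA.PartiallyOrderedDFA

variable {α σ : Type} {M : DFA α σ}

/-- A nonempty set of states of a finite partially ordered DFA has a last element. -/
theorem exists_last [Finite σ] (hM : M.PartiallyOrderedDFA) {S : Set σ} (hS : S.Nonempty) :
    ∃ x ∈ S, ∀ a, M.step x a ∈ S → M.step x a = x := by
  let r : σ → σ → Prop := fun y x => y ≠ x ∧ ∃ w : List α, M.evalFrom x w = y
  have : IsTrans σ r := by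
    refine ⟨fun x y z ⟨hxy, v, hv⟩ ⟨_, w, hw⟩ => ⟨?_, w ++ v, by rw [evalFrom_of_append, hw, hv]⟩⟩
    rintro rfl
    exact hxy (hM x y ⟨w, hw⟩ ⟨v, hv⟩)
  have : Std.Irrefl r := ⟨fun x h => h.1 rfl⟩
  obtain ⟨x, hx, hmin⟩ := (Finite.wellFounded_of_trans_of_irrefl r).has_min S hS
  refine ⟨x, hx, fun a ha => ?_⟩
  by_contra hne
  exact hmin _ ha ⟨hne, [a], by simp⟩

/-- If a letter maps a state back to itself after some steps, it fixes that state. -/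
theorem step_eq_of_iterate_eq (hM : M.PartiallyOrderedDFA) {b : α} {q : σ} {k : ℕ} (hk : 0 < k)
    (h : (fun p => M.step p b)^[k] q = q) : M.step q b = q := by
  obtain ⟨k, rfl⟩ := Nat.exists_eq_succ_of_ne_zero hk.ne'
  refine hM _ _ ⟨List.replicate k b, ?_⟩ ⟨[b], by simp⟩
  rw [evalFrom_replicate_s5]
  exact h

/-- The powers of a letter take at most `card σ` values. -/
theorem exists_iterate_eq [Fintype σ] [Nonempty σ] (hM : M.PartiallyOrderedDFA) (b : α) (k : ℕ) :
    ∃ j < Fintype.card σ, (fun p => M.step p b)^[k] = (fun p => M.step p b)^[j] := by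
  have hpos : 0 < Fintype.card σ := Fintype.card_pos
  obtain hk | hk := lt_or_ge k (Fintype.card σ)
  · exact ⟨k, hk, rfl⟩
  refine ⟨Fintype.card σ - 1, by lia, funext fun q => ?_⟩
  set s : σ → σ := fun p => M.step p b with hs
  obtain ⟨i, j, hne, hij⟩ := Fintype.exists_ne_map_eq_of_card_lt
    (fun i : Fin (Fintype.card σ + 1) => s^[i] q) (by simp)
  wlog hlt : i < j generalizing i j
  · exact this j i hne.symm hij.symm (lt_of_le_of_ne (not_lt.mp hlt) hne.symm)
  have hlt' : (i : ℕ) < j := hlt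
  have hfix : s (s^[i] q) = s^[i] q := by
    refine hM.step_eq_of_iterate_eq (k := j - i) (by lia) ?_
    rw [← hs, ← Function.iterate_add_apply, Nat.sub_add_cancel hlt'.le]
    exact hij.symm
  have hconst : ∀ l, (i : ℕ) ≤ l → s^[l] q = s^[i] q := by
    intro l hl
    obtain ⟨d, rfl⟩ := Nat.exists_eq_add_of_le' hl
    rw [Function.iterate_add_apply]
    exact Function.iterate_fixed hfix d
  rw [hconst k (by lia), hconst (Fintype.card σ - 1) (by lia)]

/-- A letter acting injectively on an invariant set of states acts trivially on it. -/
theorem step_eq_of_injOn [Finite σ] (hM : M.PartiallyOrderedDFA) {b : α} {S : Set σ}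
    (hmaps : Set.MapsTo (fun p => M.step p b) S S)
    (hinj : Set.InjOn (fun p => M.step p b) S) {q : σ} (hq : q ∈ S) : M.step q b = q := by
  obtain ⟨k, hk, h⟩ := Function.mem_periodicPts.mp
    ((hmaps.restrict_inj.mpr hinj).mem_periodicPts ⟨q, hq⟩)
  refine hM.step_eq_of_iterate_eq hk ?_
  have := congrArg Subtype.val h
  rwa [hmaps.iterate_restrict] at this

end DFA.PartiallyOrderedDFA

namespace DFA

variable {α σ : Type}

open Classical in
/-- The characteristic vector of the set of states from which `w` leads to a state whose acceptance
differs from that of the reference state `z`. -/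
noncomputable def acceptVector (M : DFA α σ) (z : σ) (w : List α) : σ → ZMod 2 :=
  fun q => if M.evalFrom q w ∈ M.accept ↔ z ∈ M.accept then 0 else 1

variable (M : DFA α σ) (z : σ)

theorem acceptVector_cons (a : α) (w : List α) (q : σ) :
    M.acceptVector z (a :: w) q = M.acceptVector z w (M.step q a) := rfl

variable {M} {z}

theorem acceptVector_eq_nil_of_forall_step_eq {q : σ} (hq : ∀ a, M.step q a = q) (w : List α) :
    M.acceptVector z w q = M.acceptVector z [] q := by
  induction w with
  | nil => rfl
  | cons a w ih => rw [acceptVector_cons, hq, ih]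

theorem acceptVector_self (hz : ∀ a, M.step z a = z) (w : List α) :
    M.acceptVector z w z = 0 := by
  rw [acceptVector_eq_nil_of_forall_step_eq hz]
  simp [acceptVector]

/-- The state complexity of the reverse is bounded by the number of accept vectors. -/
theorem stateComplexity_reverse_le [Finite σ] (M : DFA α σ) (z : σ) :
    stateComplexity M.accepts.reverse ≤ (Set.range (M.acceptVector z)).ncard := by
  let g : (σ → ZMod 2) → Language α :=
    fun f => {y | f (M.eval y.reverse) = 0 ↔ z ∈ M.accept}
  have hg : Set.range (Language.leftQuotient M.accepts.reverse) ⊆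
      g '' Set.range (M.acceptVector z) := by
    rintro _ ⟨x, rfl⟩
    refine ⟨_, ⟨x.reverse, rfl⟩, ?_⟩
    ext y
    rw [Language.mem_leftQuotient, Language.mem_reverse, List.reverse_append, mem_accepts,
      eval, evalFrom_of_append]
    change (M.acceptVector z x.reverse (M.evalFrom M.start y.reverse) = 0 ↔ z ∈ M.accept) ↔ _
    rw [acceptVector]
    split_ifs with h <;> simp <;> tauto
  rw [stateComplexity_eq_ncard ((Set.toFinite _).subset hg)]
  exact (Set.ncard_le_ncard hg (Set.toFinite _)).trans Set.ncard_image_le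

end DFA

/-- There are at most `2 ^ (card σ - card X)` binary vectors with prescribed entries on `X`. -/
theorem ncard_eqOn_le {σ : Type*} [Fintype σ] [DecidableEq σ] (X : Finset σ) (g : σ → ZMod 2) :
    {f : σ → ZMod 2 | ∀ x ∈ X, f x = g x}.ncard ≤ 2 ^ (Fintype.card σ - X.card) := by
  have hcard : Nat.card ({q // q ∉ X} → ZMod 2) = 2 ^ (Fintype.card σ - X.card) := by
    simp [Fintype.card_subtype_compl]
  rw [← hcard, ← Nat.card_coe_set_eq]
  refine Nat.card_le_card_of_injective (fun f q => f.1 q.1) ?_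
  rintro ⟨f, hf⟩ ⟨f', hf'⟩ h
  ext q
  by_cases hq : q ∈ X
  · exact (hf q hq).trans (hf' q hq).symm
  · exact congrFun h ⟨q, hq⟩

theorem two_mul_le_two_pow_sub_four {n : ℕ} (hn : 8 ≤ n) : 2 * n ≤ 2 ^ (n - 4) := by
  obtain ⟨k, rfl⟩ := Nat.exists_eq_add_of_le hn
  rw [show 8 + k - 4 = k + 4 by lia, pow_add]
  have := Nat.lt_two_pow_self (n := k)
  lia

/-- Precomposition with `t`, on binary vectors supported outside `X`. -/
def pullbackOff {σ : Type*} [DecidableEq σ] (X : Finset σ) (t : σ → σ) :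
    ({q // q ∉ X} → ZMod 2) →+ ({q // q ∉ X} → ZMod 2) where
  toFun g q := if h : t q ∉ X then g ⟨t q, h⟩ else 0
  map_zero' := by ext q; simp
  map_add' g g' := by
    ext q
    by_cases h : t q ∈ X <;> simp [h]

/-- If precomposition with a letter is surjective off `X`, the letter acts trivially there. -/
theorem DFA.PartiallyOrderedDFA.step_eq_of_range_pullbackOff_eq_top {α σ : Type} [Finite σ]
    [DecidableEq σ] {M : DFA α σ} (hM : M.PartiallyOrderedDFA) {X : Finset σ} {a : α}
    (h : (pullbackOff X (fun q => M.step q a)).range = ⊤) {q : σ} (hq : q ∉ X) :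
    M.step q a = q := by
  have key : ∀ r (hr : r ∉ X), ∃ g : {q // q ∉ X} → ZMod 2, ∀ q (hq : q ∉ X),
      (if h : M.step q a ∉ X then g ⟨M.step q a, h⟩ else 0) = if q = r then 1 else 0 := by
    intro r hr
    obtain ⟨g, hg⟩ := AddMonoidHom.range_eq_top.mp h (fun q => if q.1 = r then 1 else 0)
    exact ⟨g, fun q hq => congrFun hg ⟨q, hq⟩⟩
  refine hM.step_eq_of_injOn (S := {q | q ∉ X}) ?_ ?_ hq
  · intro r hr
    obtain ⟨g, hg⟩ := key r hr
    have := hg r hr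
    by_contra hmem
    simp only [Set.mem_ofPred_eq, not_not] at hmem
    simp [hmem] at this
  · intro r hr r' hr' hrr
    obtain ⟨g, hg⟩ := key r hr
    have h1 := hg r hr
    have h2 := hg r' hr'
    simp only at hrr
    simp only [hrr, if_true] at h1
    rw [h1] at h2
    by_contra hne
    simp [Ne.symm hne] at h2

namespace DFA.PartiallyOrderedDFA

variable {σ : Type} [Fintype σ] {M : DFA (Fin 2) σ} {z p : σ}

/-- If `p` is a penultimate state, all but few accept vectors arise by prepending a letter to a word
whose accept vector vanishes at `p`. -/
theorem exists_exceptional_acceptVectors (hM : M.PartiallyOrderedDFA)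
    (hcard : 3 ≤ 2 * Fintype.card σ) (hz : ∀ a, M.step z a = z)
    (hp : ∀ a, M.step p a = p ∨ M.step p a = z) (hpz : ∃ a, M.step p a = z) :
    ∃ E : Set (σ → ZMod 2), E.ncard ≤ 2 * Fintype.card σ ∧ ∀ w, M.acceptVector z w ∈ E ∨
      ∃ a v, w = a :: v ∧ M.acceptVector z v p = 0 ∧ M.acceptVector z w p = 0 := by
  have : Nonempty σ := ⟨z⟩
  have hstep : ∀ v, M.acceptVector z v p = 0 → ∀ a, M.acceptVector z (a :: v) p = 0 := by
    intro v hv a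
    rw [acceptVector_cons]
    obtain h | h := hp a <;> rw [h]
    · exact hv
    · exact acceptVector_self hz v
  obtain ⟨a, ha⟩ := hpz
  by_cases hall : ∀ b, M.step p b = z
  · refine ⟨{M.acceptVector z [], M.acceptVector z [0], M.acceptVector z [1]}, ?_, ?_⟩
    · refine le_trans ?_ hcard
      refine (Set.ncard_insert_le _ _).trans ?_
      have := Set.ncard_insert_le (M.acceptVector z [0]) {M.acceptVector z [1]}
      rw [Set.ncard_singleton] at this
      lia
    · rintro (_ | ⟨b, _ | ⟨c, v⟩⟩)
      · simp
      · left
        fin_cases b <;> simp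
      · right
        have h0 : M.acceptVector z (c :: v) p = 0 := by
          rw [acceptVector_cons, hall, acceptVector_self hz]
        exact ⟨b, _, rfl, h0, hstep _ h0 b⟩
  · push Not at hall
    obtain ⟨b, hb⟩ := hall
    have hab : ∀ c, c = a ∨ c = b := by
      have : a ≠ b := by rintro rfl; exact hb ha
      intro c
      lia
    have hrep : ∀ v, M.acceptVector z v p ≠ 0 → ∃ k, v = List.replicate k b := by
      intro v
      induction v with
      | nil => exact fun _ => ⟨0, rfl⟩
      | cons c v ih =>
        intro hv
        obtain rfl | rfl := hab c
        · exact absurd (by rw [acceptVector_cons, ha, acceptVector_self hz]) hv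
        · obtain ⟨k, rfl⟩ := ih fun h => hv (hstep v h c)
          exact ⟨k + 1, rfl⟩
    have hshort : ∀ k, ∃ j < Fintype.card σ,
        M.acceptVector z (List.replicate k b) = M.acceptVector z (List.replicate j b) := by
      intro k
      obtain ⟨j, hj, h⟩ := hM.exists_iterate_eq b k
      refine ⟨j, hj, funext fun q => ?_⟩
      have hq : M.evalFrom q (List.replicate k b) = M.evalFrom q (List.replicate j b) := by
        rw [evalFrom_replicate_s5, evalFrom_replicate_s5, h]
      rw [acceptVector, acceptVector, hq]
    let f : ℕ → σ → ZMod 2 := fun k => M.acceptVector z (List.replicate k b)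
    let g : ℕ → σ → ZMod 2 := fun k => M.acceptVector z (a :: List.replicate k b)
    refine ⟨f '' Set.Iio (Fintype.card σ) ∪ g '' Set.Iio (Fintype.card σ), ?_, fun w => ?_⟩
    · refine (Set.ncard_union_le _ _).trans ?_
      have h1 := Set.ncard_image_le (f := f) (Set.finite_Iio (Fintype.card σ))
      have h2 := Set.ncard_image_le (f := g) (Set.finite_Iio (Fintype.card σ))
      have h3 : (Set.Iio (Fintype.card σ)).ncard = Fintype.card σ := by
        rw [Set.ncard_eq_toFinset_card', Set.toFinset_Iio, Nat.card_Iio]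
      lia
    · have hpow : ∀ k, M.acceptVector z (List.replicate k b) ∈ f '' Set.Iio (Fintype.card σ) := by
        intro k
        obtain ⟨j, hj, h⟩ := hshort k
        exact ⟨j, hj, h.symm⟩
      obtain _ | ⟨c, v⟩ := w
      · exact .inl (.inl (hpow 0))
      by_cases hv : M.acceptVector z v p = 0
      · exact .inr ⟨c, v, rfl, hv, hstep v hv c⟩
      obtain ⟨k, rfl⟩ := hrep v hv
      left
      obtain rfl | rfl := hab c
      · right
        obtain ⟨j, hj, h⟩ := hshort k
        refine ⟨j, hj, funext fun q => ?_⟩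
        simp only [g, acceptVector_cons, h]
      · exact .inl (hpow (k + 1))

theorem ncard_range_acceptVector_le (hM : M.PartiallyOrderedDFA) (hcard : 8 ≤ Fintype.card σ) :
    ∃ z, (Set.range (M.acceptVector z)).ncard ≤ 2 ^ (Fintype.card σ - 2) := by
  classical
  set n := Fintype.card σ with hn
  have hpow : 2 ^ (n - 2) = 4 * 2 ^ (n - 4) := by
    rw [show n - 2 = (n - 4) + 2 by lia, pow_add]; ring
  have hpow' : 2 ^ (n - 3) = 2 * 2 ^ (n - 4) := by
    rw [show n - 3 = (n - 4) + 1 by lia, pow_add]; ring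
  have hsmall := two_mul_le_two_pow_sub_four hcard
  have hex : ∀ X : Finset σ, X.card < n → ∃ x ∉ X, ∀ a, M.step x a = x ∨ M.step x a ∈ X := by
    intro X hX
    obtain ⟨x, hx⟩ : ∃ x, x ∉ X := by
      by_contra! h
      exact hX.ne (X.card_eq_iff_eq_univ.mpr (Finset.eq_univ_iff_forall.mpr h))
    obtain ⟨y, hy, h⟩ := hM.exists_last (S := {x | x ∉ X}) ⟨x, hx⟩
    refine ⟨y, hy, fun a => ?_⟩
    by_cases hmem : M.step y a ∈ X
    · exact .inr hmem
    · exact .inl (h a hmem)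
  obtain ⟨z, -, hz⟩ := hex ∅ (by simp; lia)
  replace hz : ∀ a, M.step z a = z := fun a => (hz a).resolve_right (Finset.notMem_empty _)
  refine ⟨z, ?_⟩
  have htwo : ∀ x, x ≠ z → (∀ a, M.step x a = x) →
      (Set.range (M.acceptVector z)).ncard ≤ 2 ^ (n - 2) := by
    intro x hxz hx
    have hX : ({x, z} : Finset σ).card = 2 := Finset.card_pair hxz
    have hle := ncard_eqOn_le {x, z} (M.acceptVector z [])
    rw [hX] at hle
    refine (Set.ncard_le_ncard ?_ (Set.toFinite _)).trans hle
    rintro _ ⟨w, rfl⟩ q hq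
    rw [Finset.mem_insert, Finset.mem_singleton] at hq
    obtain rfl | rfl := hq
    · exact acceptVector_eq_nil_of_forall_step_eq hx w
    · exact acceptVector_eq_nil_of_forall_step_eq hz w
  obtain ⟨p, hpz, hp⟩ := hex {z} (by simp; lia)
  simp only [Finset.mem_singleton] at hpz hp
  by_cases hpfix : ∀ a, M.step p a = p
  · exact htwo p hpz hpfix
  have hpz' : ∃ a, M.step p a = z := by
    push Not at hpfix
    obtain ⟨a, ha⟩ := hpfix
    exact ⟨a, (hp a).resolve_left ha⟩
  obtain ⟨E, hEcard, hE⟩ := hM.exists_exceptional_acceptVectors (by lia) hz hp hpz'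
  have hX : ({p, z} : Finset σ).card = 2 := Finset.card_pair hpz
  by_cases hproper : ∀ a, (pullbackOff {p, z} (fun q => M.step q a)).range ≠ ⊤
  · let H : Fin 2 → AddSubgroup ({q // q ∉ ({p, z} : Finset σ)} → ZMod 2) :=
      fun a => (pullbackOff {p, z} (fun q => M.step q a)).range
    let ext : ({q // q ∉ ({p, z} : Finset σ)} → ZMod 2) → σ → ZMod 2 :=
      fun g q => if h : q ∉ ({p, z} : Finset σ) then g ⟨q, h⟩ else 0
    have hsub : Set.range (M.acceptVector z) ⊆ E ∪ ext '' ((H 0).carrier ∪ (H 1).carrier) := by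
      rintro _ ⟨w, rfl⟩
      obtain h | ⟨a, v, rfl, hv, hw⟩ := hE w
      · exact .inl h
      have hmem : (pullbackOff {p, z} fun q => M.step q a) (fun q => M.acceptVector z v q) ∈
          (H 0).carrier ∪ (H 1).carrier := by
        fin_cases a
        · exact .inl ⟨_, rfl⟩
        · exact .inr ⟨_, rfl⟩
      have hout : ∀ u, M.acceptVector z u p = 0 → ∀ q ∈ ({p, z} : Finset σ),
          M.acceptVector z u q = 0 := by
        intro u hu q hq
        rw [Finset.mem_insert, Finset.mem_singleton] at hq
        obtain rfl | rfl := hq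
        · exact hu
        · exact acceptVector_self hz u
      refine .inr ⟨_, hmem, funext fun q => ?_⟩
      by_cases h1 : q ∈ ({p, z} : Finset σ)
      · rw [hout _ hw q h1]
        exact dif_neg (not_not.mpr h1)
      · refine (dif_pos h1).trans ?_
        rw [acceptVector_cons]
        by_cases h2 : M.step q a ∈ ({p, z} : Finset σ)
        · rw [hout v hv _ h2]
          exact dif_neg (not_not.mpr h2)
        · exact dif_pos h2
    have hV : Nat.card ({q // q ∉ ({p, z} : Finset σ)} → ZMod 2) = 2 ^ (n - 2) := by
      rw [Nat.card_fun, Nat.card_zmod, Nat.card_eq_fintype_card, Fintype.card_subtype_compl,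
        Fintype.card_coe, hX]
    have h34 := AddSubgroup.four_mul_ncard_union_le (hproper 0) (hproper 1)
    rw [hV] at h34
    have h1 := Set.ncard_le_ncard hsub (Set.toFinite _)
    have h2 := Set.ncard_union_le E (ext '' ((H 0).carrier ∪ (H 1).carrier))
    have h3 := Set.ncard_image_le (f := ext) (s := (H 0).carrier ∪ (H 1).carrier) (Set.toFinite _)
    have h4 : 4 * ((H 0).carrier ∪ (H 1).carrier).ncard ≤ 3 * 2 ^ (n - 2) := h34
    lia
  · push Not at hproper
    obtain ⟨c, hc⟩ := hproper
    have hfix : ∀ q, q ∉ ({p, z} : Finset σ) → M.step q c = q :=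
      fun q => hM.step_eq_of_range_pullbackOff_eq_top hc
    obtain ⟨r, hr, hr'⟩ := hex {p, z} (by lia)
    simp only [Finset.mem_insert, Finset.mem_singleton, not_or] at hr hr' hfix
    by_cases hrfix : ∀ a, M.step r a = r
    · exact htwo r hr.2 hrfix
    push Not at hrfix
    obtain ⟨d, hd⟩ := hrfix
    have hd' := (hr' d).resolve_left hd
    have hcd : ∀ e, e = c ∨ e = d := by
      have : c ≠ d := by rintro rfl; exact hd (hfix r ⟨hr.1, hr.2⟩)
      intro e
      lia
    have hsub : Set.range (M.acceptVector z) ⊆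
        E ∪ {f | ∀ x ∈ ({r, p, z} : Finset σ), f x = (0 : σ → ZMod 2) x} := by
      rintro _ ⟨w, rfl⟩
      induction w with
      | nil =>
        obtain h | ⟨a, v, h, -⟩ := hE []
        · exact .inl h
        · simp at h
      | cons e w ih =>
        obtain h | ⟨a, v, h, hv, hw⟩ := hE (e :: w)
        · exact .inl h
        obtain ⟨rfl, rfl⟩ := List.cons_eq_cons.mp h
        have goal_of : M.acceptVector z (e :: w) r = 0 → M.acceptVector z (e :: w) ∈
            E ∪ {f | ∀ x ∈ ({r, p, z} : Finset σ), f x = (0 : σ → ZMod 2) x} := by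
          intro h0
          refine .inr fun x hx => ?_
          simp only [Finset.mem_insert, Finset.mem_singleton] at hx
          obtain rfl | rfl | rfl := hx
          · exact h0
          · exact hw
          · exact acceptVector_self hz _
        obtain rfl | rfl := hcd e
        · obtain ih | ih := ih
          · left
            convert ih using 1
            ext q
            by_cases hq : q = p ∨ q = z
            · obtain rfl | rfl := hq
              · rw [hw, hv]
              · rw [acceptVector_self hz, acceptVector_self hz]
            · rw [acceptVector_cons, hfix q (not_or.mp hq)]
          · apply goal_of
            rw [acceptVector_cons, hfix r hr]
            exact ih r (by simp)
        · apply goal_of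
          rw [acceptVector_cons]
          obtain h | h := hd' <;> rw [h]
          · exact hv
          · exact acceptVector_self hz w
    have hX' : ({r, p, z} : Finset σ).card = 3 := by
      rw [Finset.card_insert_of_notMem (by simpa using hr), hX]
    have h1 := Set.ncard_le_ncard hsub (Set.toFinite _)
    have h2 := Set.ncard_union_le E {f | ∀ x ∈ ({r, p, z} : Finset σ), f x = (0 : σ → ZMod 2) x}
    have h3 := ncard_eqOn_le ({r, p, z} : Finset σ) 0
    rw [hX'] at h3
    lia

end DFA.PartiallyOrderedDFA

/-- The DFA of the binary words whose `m`-th letter is `1`. -/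
def nthLetterDFA (m : ℕ) : DFA (Fin 2) (Fin (m + 2)) where
  step i c :=
    if h : i.val + 1 < m then ⟨i + 1, by lia⟩
    else if i.val < m then (if c = 1 then ⟨m, by lia⟩ else ⟨m + 1, by lia⟩)
    else i
  start := 0
  accept := {⟨m, by lia⟩}

namespace nthLetterDFA

variable {m : ℕ}

theorem evalFrom_of_le (i : Fin (m + 2)) (hi : m ≤ i) (w : List (Fin 2)) :
    (nthLetterDFA m).evalFrom i w = i := by
  induction w with
  | nil => rfl
  | cons c w ih =>
    have : (nthLetterDFA m).step i c = i := by
      simp only [nthLetterDFA]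
      rw [dif_neg (by lia), if_neg (by lia)]
    rw [DFA.evalFrom_cons, this, ih]

theorem evalFrom_mem_accept_iff (i : Fin (m + 2)) (hi : i.val < m) (w : List (Fin 2)) :
    (nthLetterDFA m).evalFrom i w ∈ (nthLetterDFA m).accept ↔ w[m - 1 - i]? = some 1 := by
  induction w generalizing i with
  | nil =>
    simp only [DFA.evalFrom_nil, nthLetterDFA, Set.mem_singleton_iff, List.getElem?_nil, Fin.ext_iff]
    simpa using hi.ne
  | cons c w ih =>
    rw [DFA.evalFrom_cons]
    by_cases h : i.val + 1 < m
    · have hs : (nthLetterDFA m).step i c = ⟨i + 1, by lia⟩ := by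
        simp only [nthLetterDFA]
        rw [dif_pos h]
      rw [hs, ih _ h, show m - 1 - i.val = (m - 1 - (i.val + 1)) + 1 by lia, List.getElem?_cons_succ]
    · have hs : (nthLetterDFA m).step i c = if c = 1 then ⟨m, by lia⟩ else ⟨m + 1, by lia⟩ := by
        simp only [nthLetterDFA]
        rw [dif_neg h, if_pos hi]
      rw [hs, evalFrom_of_le _ (by split_ifs <;> simp), show m - 1 - i.val = 0 by lia,
        List.getElem?_cons_zero]
      split_ifs with hc <;> simp [nthLetterDFA, hc]

theorem evalFrom_replicate_one (i k : ℕ) (h : i + k ≤ m) :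
    (nthLetterDFA m).evalFrom ⟨i, by lia⟩ (List.replicate k 1) = ⟨i + k, by lia⟩ := by
  induction k generalizing i with
  | zero => rfl
  | succ k ih =>
    have hs : (nthLetterDFA m).step ⟨i, by lia⟩ 1 = ⟨i + 1, by lia⟩ := by
      simp only [nthLetterDFA]
      split_ifs <;> simp <;> lia
    rw [List.replicate_succ, DFA.evalFrom_cons, hs, ih (i + 1) (by lia)]
    simp only [Fin.mk.injEq]
    lia

theorem le_evalFrom (i : Fin (m + 2)) (w : List (Fin 2)) :
    i ≤ (nthLetterDFA m).evalFrom i w := by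
  induction w generalizing i with
  | nil => exact le_rfl
  | cons c w ih =>
    refine le_trans ?_ (ih _)
    simp only [nthLetterDFA]
    split_ifs <;> simp [Fin.le_def] <;> lia

theorem partiallyOrderedDFA (m : ℕ) : (nthLetterDFA m).PartiallyOrderedDFA := by
  rintro p q ⟨v, hv⟩ ⟨w, hw⟩
  exact le_antisymm (hv ▸ le_evalFrom p v) (hw ▸ le_evalFrom q w)

theorem minimalDFA (hm : 0 < m) : (nthLetterDFA m).MinimalDFA := by
  constructor
  · intro q
    by_cases hq : q.val ≤ m
    · refine ⟨List.replicate q 1, ?_⟩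
      have := evalFrom_replicate_one 0 q.val (m := m) (by lia)
      simp only [zero_add] at this
      exact this
    · refine ⟨List.replicate (m - 1) 1 ++ [0], ?_⟩
      have := evalFrom_replicate_one 0 (m - 1) (m := m) (by lia)
      rw [DFA.evalFrom_of_append]
      change (nthLetterDFA m).evalFrom ((nthLetterDFA m).evalFrom ⟨0, _⟩ _) _ = _
      rw [this, DFA.evalFrom_singleton]
      simp only [nthLetterDFA]
      rw [dif_neg (by lia), if_pos (by lia), if_neg (by simp)]
      ext
      simp only
      lia
  · intro p q hpq
    wlog hlt : p < q generalizing p q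
    · obtain ⟨w, hw⟩ := this q p hpq.symm (lt_of_le_of_ne (not_lt.mp hlt) hpq.symm)
      exact ⟨w, fun h => hw h.symm⟩
    have hlt' : p.val < q.val := hlt
    by_cases hq : q.val ≤ m
    · refine ⟨List.replicate (m - q) 1, ?_⟩
      rw [show p = ⟨p.val, by lia⟩ from rfl, show q = ⟨q.val, by lia⟩ from rfl,
        evalFrom_replicate_one _ _ (by lia), evalFrom_replicate_one _ _ (by lia)]
      simp only [nthLetterDFA, Set.mem_singleton_iff, Fin.mk.injEq]
      lia
    · refine ⟨List.replicate (m - p) 1, ?_⟩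
      rw [evalFrom_of_le q (by lia), show p = ⟨p.val, by lia⟩ from rfl,
        evalFrom_replicate_one _ _ (by lia)]
      simp only [nthLetterDFA, Set.mem_singleton_iff, Fin.ext_iff]
      lia

theorem mem_accepts_iff (hm : 0 < m) (w : List (Fin 2)) :
    w ∈ (nthLetterDFA m).accepts ↔ w[m - 1]? = some 1 :=
  evalFrom_mem_accept_iff 0 hm w

theorem two_pow_le_ncard_leftQuotient_reverse (hm : 0 < m)
    (hfin : (Set.range (Language.leftQuotient (nthLetterDFA m).accepts.reverse)).Finite) :
    2 ^ m ≤ (Set.range (Language.leftQuotient (nthLetterDFA m).accepts.reverse)).ncard := by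
  have := hfin.to_subtype
  let F : (Fin m → Fin 2) → Set.range (Language.leftQuotient (nthLetterDFA m).accepts.reverse) :=
    fun f => ⟨_, List.ofFn f, rfl⟩
  have hF : Function.Injective F := by
    intro f g hfg
    have key : ∀ (f : Fin m → Fin 2) (i : Fin m),
        List.replicate i.val 0 ∈ (F f).1 ↔ f i = 1 := by
      intro f i
      have hi := i.isLt
      change List.ofFn f ++ List.replicate i.val 0 ∈ (nthLetterDFA m).accepts.reverse ↔ _
      rw [Language.mem_reverse, mem_accepts_iff hm, List.getElem?_reverse (by simp; lia)]
      simp only [List.length_append, List.length_ofFn, List.length_replicate]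
      rw [show m + i.val - 1 - (m - 1) = i.val by lia, List.getElem?_append_left (by simp)]
      simp
    ext i
    have := key f i
    rw [hfg, key g i] at this
    lia
  have := Nat.card_le_card_of_injective F hF
  rw [Nat.card_coe_set_eq] at this
  simpa using this

end nthLetterDFA

theorem DFA.PartiallyOrderedDFA.stateComplexity_reverse_le {n : ℕ} (hn : 8 ≤ n)
    {M : DFA (Fin 2) (Fin n)} (hM : M.PartiallyOrderedDFA) :
    stateComplexity M.accepts.reverse ≤ 2 ^ (n - 2) := by
  obtain ⟨z, hz⟩ := hM.ncard_range_acceptVector_le (by simpa using hn)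
  rw [Fintype.card_fin] at hz
  exact (M.stateComplexity_reverse_le z).trans hz

theorem statement5 (n : ℕ) (hn : 8 ≤ n) :
    (∀ L : Language (Fin 2), IsRTrivial L → stateComplexity L = n →
      stateComplexity L.reverse ≤ 2 ^ (n - 2)) ∧
    (∃ L : Language (Fin 2), IsRTrivial L ∧ stateComplexity L = n ∧
      stateComplexity L.reverse = 2 ^ (n - 2)) := by
  constructor
  · rintro _ ⟨k, M, hmin, rfl, hpo⟩ rfl
    rw [hmin.stateComplexity_accepts] at hn ⊢
    exact hpo.stateComplexity_reverse_le hn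
  · obtain ⟨m, rfl⟩ := Nat.exists_eq_add_of_le' (show 2 ≤ n by lia)
    have hm : 0 < m := by lia
    have hmin := nthLetterDFA.minimalDFA hm
    refine ⟨_, ⟨_, _, hmin, rfl, nthLetterDFA.partiallyOrderedDFA m⟩,
      hmin.stateComplexity_accepts, ?_⟩
    refine le_antisymm
      ((nthLetterDFA.partiallyOrderedDFA m).stateComplexity_reverse_le hn) ?_
    have hreg : (nthLetterDFA m).accepts.IsRegular := ⟨_, inferInstance, _, rfl⟩
    have hfin := hreg.reverse.finite_range_leftQuotient
    rw [stateComplexity_eq_ncard hfin]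
    exact nthLetterDFA.two_pow_le_ncard_leftQuotient_reverse hm hfin
end
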